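/- There exist constants K₁, K₂ > 0, depending only on the base graph Ĝ and not on n, such that for every n ≥ 1 and every vertex x ∈ Σ_n of Ĝ_n, the local clustering coefficient satisfies K₁ / deĝ_n(x) ≤ C_x ≤ K₂ / deĝ_n(x). -/

import Mathlib

noncomputable section
attribute [local instance] Classical.propDecidable

namespace HierGraph

open Finset MeasureTheory ProbabilityTheory

variable {N : ℕ}

/-- The degree of a vertex in a finite simple graph. -/
def degH {α : Type*} [Fintype α] (H : SimpleGraph α) (v : α) : ℕ :=
  (univ.filter fun w => H.Adj v w).card

/-- The length `|x ∧ y|` of the longest common prefix of two words. -/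
def prefixLen {n : ℕ} (x y : Fin n → Fin N) : ℕ :=
  (univ.filter fun i : Fin n => ∀ j : Fin n, j ≤ i → x j = y j).card

/-- The postfix of `x` starting at position `k` has constant type
(`t = true` ↔ all its letters lie in `V1`). -/
def postfixType (V1 : Finset (Fin N)) {n : ℕ} (k : ℕ) (x : Fin n → Fin N) (t : Bool) : Prop :=
  ∀ i : Fin n, k ≤ i.val → (x i ∈ V1 ↔ t = true)

/-- The edge relation of the graph `Gₙ` (loops included): `x = y`, or the two postfixes
after the common prefix have types `{1,2}` and corresponding letters are adjacent in `G`. -/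
def EdgeRel (G : SimpleGraph (Fin N)) (V1 : Finset (Fin N)) {n : ℕ} (x y : Fin n → Fin N) :
    Prop :=
  x = y ∨
    ((∃ t : Bool, postfixType V1 (prefixLen x y) x t ∧ postfixType V1 (prefixLen x y) y (!t)) ∧
      ∀ i : Fin n, prefixLen x y ≤ i.val → G.Adj (x i) (y i))

/-- The degree of a vertex of `Gₙ`, the loop counting `2`. -/
def degGn (G : SimpleGraph (Fin N)) (V1 : Finset (Fin N)) {n : ℕ} (x : Fin n → Fin N) : ℕ :=
  2 + (univ.filter fun y : Fin n → Fin N => y ≠ x ∧ EdgeRel G V1 x y).card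

/-- `ℓ(x)`: the length of the longest suffix of `x` of constant (nonzero) type. -/
def ell (V1 : Finset (Fin N)) {n : ℕ} (x : Fin n → Fin N) : ℕ :=
  ((Finset.Icc 1 n).filter fun i =>
    (∀ j : Fin n, n - i ≤ j.val → x j ∈ V1) ∨ ∀ j : Fin n, n - i ≤ j.val → x j ∉ V1).sup id

/-- `S(x) = Σ_{r=0}^{ℓ(x)-1} Π_{j=1}^{r} deg(x_{n-j})`. -/
def Sx (G : SimpleGraph (Fin N)) (V1 : Finset (Fin N)) {n : ℕ} (hn : 0 < n)
    (x : Fin n → Fin N) : ℕ :=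
  ∑ r ∈ Finset.range (ell V1 x), ∏ j ∈ Finset.Icc 1 r, degH G (x ⟨n - 1 - j, by omega⟩)

/-- The simple graph `Gₙ` (loops removed). -/
def GnSimple (G : SimpleGraph (Fin N)) (V1 : Finset (Fin N)) (n : ℕ) :
    SimpleGraph (Fin n → Fin N) :=
  SimpleGraph.fromRel (EdgeRel G V1)

/-- The diameter of a finite graph: the maximal graph distance. -/
def fdiam {α : Type*} [Fintype α] (H : SimpleGraph α) : ℕ :=
  univ.sup fun p : α × α => H.dist p.1 p.2

/-- The number of maximal constant-type blocks of the postfix of `x` starting at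
position `k` (`k < n`). -/
def blockCount (V1 : Finset (Fin N)) {n : ℕ} (k : ℕ) (x : Fin n → Fin N) : ℕ :=
  1 + (univ.filter fun i : Fin n =>
        k ≤ i.val ∧ ∃ h : i.val + 1 < n, ¬((x i ∈ V1) ↔ x ⟨i.val + 1, h⟩ ∈ V1)).card

/-- The left endpoint of the `N`-adic interval `I_x`. -/
def Ipt {n : ℕ} (x : Fin n → Fin N) : ℝ := ∑ r : Fin n, (x r : ℝ) / (N : ℝ) ^ (r.val + 1)

/-- The `N`-adic interval `I_x ⊆ [0,1]`. -/
def Iset {n : ℕ} (x : Fin n → Fin N) : Set ℝ := Set.Icc (Ipt x) (Ipt x + 1 / (N : ℝ) ^ n)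

/-- The level-`n` square `Q_{(x,y)} = I_x × I_y`. -/
def Qset {n : ℕ} (x y : Fin n → Fin N) : Set (ℝ × ℝ) := Iset x ×ˢ Iset y

/-- `Λₙ`: the embedded adjacency matrix of `Gₙ` in the unit square. -/
def Lam (G : SimpleGraph (Fin N)) (V1 : Finset (Fin N)) (n : ℕ) : Set (ℝ × ℝ) :=
  ⋃ (p : (Fin n → Fin N) × (Fin n → Fin N)) (_ : EdgeRel G V1 p.1 p.2), Qset p.1 p.2

/-- `Λ = ⋂_{n ≥ 1} Λₙ`. -/
def LamInf (G : SimpleGraph (Fin N)) (V1 : Finset (Fin N)) : Set (ℝ × ℝ) :=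
  ⋂ (n : ℕ) (_ : 1 ≤ n), Lam G V1 n

/-- The homothety `f_v(a,b) = ((a,b) + v)/N` for `v ∈ Σ₁ × Σ₁`. -/
def fmap (N : ℕ) (v : Fin N × Fin N) : ℝ × ℝ → ℝ × ℝ :=
  fun p => ((p.1 + (v.1 : ℝ)) / N, (p.2 + (v.2 : ℝ)) / N)

/-- `f_v = f_{v₁} ∘ ⋯ ∘ f_{vₙ}` for a word `v` over `Σ₁ × Σ₁` (identity for the empty word). -/
def fpath {n : ℕ} (v : Fin n → Fin N × Fin N) : ℝ × ℝ → ℝ × ℝ :=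
  (List.ofFn fun i => fmap N (v i)).foldr (· ∘ ·) id

/-- The unit square `[0,1]²`. -/
def unitSq : Set (ℝ × ℝ) := Set.Icc (0 : ℝ) 1 ×ˢ Set.Icc (0 : ℝ) 1

/-- The diagonal `{(t,t) : t ∈ [0,1]}`. -/
def DiagSet : Set (ℝ × ℝ) := (fun t : ℝ => (t, t)) '' Set.Icc (0 : ℝ) 1

/-- `V_dd`, the diagonal vertices of the directed graph `𝒢`. -/
def Vdd (v : Fin N × Fin N) : Prop := v.1 = v.2

/-- `V₁₂`, vertices of `𝒢` coming from edges of `G` directed from `V₁` to `V₂`. -/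
def V12 (G : SimpleGraph (Fin N)) (V1 : Finset (Fin N)) (v : Fin N × Fin N) : Prop :=
  v.1 ∈ V1 ∧ v.2 ∉ V1 ∧ G.Adj v.1 v.2

/-- `V₂₁`, vertices of `𝒢` coming from edges of `G` directed from `V₂` to `V₁`. -/
def V21 (G : SimpleGraph (Fin N)) (V1 : Finset (Fin N)) (v : Fin N × Fin N) : Prop :=
  v.1 ∉ V1 ∧ v.2 ∈ V1 ∧ G.Adj v.1 v.2

/-- Vertices of the directed graph `𝒢`. -/
def calGVert (G : SimpleGraph (Fin N)) (V1 : Finset (Fin N)) (v : Fin N × Fin N) : Prop :=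
  Vdd v ∨ V12 G V1 v ∨ V21 G V1 v

/-- Directed edges of `𝒢`: all pairs (loops included) within each of `V_dd`, `V₁₂`, `V₂₁`,
plus one edge from each vertex of `V_dd` to each vertex of `V₁₂ ∪ V₂₁`. -/
def calGEdge (G : SimpleGraph (Fin N)) (V1 : Finset (Fin N)) (u v : Fin N × Fin N) : Prop :=
  (Vdd u ∧ Vdd v) ∨ (V12 G V1 u ∧ V12 G V1 v) ∨ (V21 G V1 u ∧ V21 G V1 v) ∨
    (Vdd u ∧ (V12 G V1 v ∨ V21 G V1 v))

/-- `v ∈ 𝒫ₙ`: `v` is a directed path of length `n` in `𝒢`. -/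
def IsPathCalG (G : SimpleGraph (Fin N)) (V1 : Finset (Fin N)) {n : ℕ}
    (v : Fin n → Fin N × Fin N) : Prop :=
  (∀ i, calGVert G V1 (v i)) ∧
    ∀ i j : Fin n, (j : ℕ) = (i : ℕ) + 1 → calGEdge G V1 (v i) (v j)

/-- Non-loop edges of `Gₙ`, i.e. edges of `G'ₙ`. -/
def GnEdge' (G : SimpleGraph (Fin N)) (V1 : Finset (Fin N)) {n : ℕ} (x y : Fin n → Fin N) :
    Prop :=
  x ≠ y ∧ EdgeRel G V1 x y

/-- The extra edges `RE(Ĝₙ)`: the two words agree except in the last letter, and the last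
letters form an extra edge (an edge of `R`). -/
def REn (R : SimpleGraph (Fin N)) {n : ℕ} (x y : Fin n → Fin N) : Prop :=
  ∃ h : 0 < n, (∀ i : Fin n, i.val + 1 < n → x i = y i) ∧
    R.Adj (x ⟨n - 1, Nat.sub_lt h Nat.one_pos⟩) (y ⟨n - 1, Nat.sub_lt h Nat.one_pos⟩)

/-- Adjacency in `Ĝₙ`. -/
def hatAdj (G R : SimpleGraph (Fin N)) (V1 : Finset (Fin N)) {n : ℕ} (x y : Fin n → Fin N) :
    Prop :=
  GnEdge' G V1 x y ∨ REn R x y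

/-- The graph `Ĝₙ`. -/
def HatGn (G R : SimpleGraph (Fin N)) (V1 : Finset (Fin N)) (n : ℕ) :
    SimpleGraph (Fin n → Fin N) :=
  SimpleGraph.fromRel (hatAdj G R V1)

/-- Property R: every `x ∈ Σ₁` lies in a triangle having two edges in `E(G)` and
one extra edge (an edge of `R`). -/
def PropertyR (G R : SimpleGraph (Fin N)) : Prop :=
  ∀ x : Fin N, ∃ y z : Fin N,
    (G.Adj x y ∧ G.Adj x z ∧ R.Adj y z) ∨ (G.Adj x y ∧ R.Adj x z ∧ G.Adj y z) ∨
      (R.Adj x y ∧ G.Adj x z ∧ G.Adj y z)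

/-- Exactly two of the three edges of the triangle `(x,y,z)` are non-loop edges of `Gₙ`. -/
def exactlyTwoG (G : SimpleGraph (Fin N)) (V1 : Finset (Fin N)) {n : ℕ}
    (x y z : Fin n → Fin N) : Prop :=
  (GnEdge' G V1 x y ∧ GnEdge' G V1 x z ∧ ¬GnEdge' G V1 y z) ∨
    (GnEdge' G V1 x y ∧ ¬GnEdge' G V1 x z ∧ GnEdge' G V1 y z) ∨
      (¬GnEdge' G V1 x y ∧ GnEdge' G V1 x z ∧ GnEdge' G V1 y z)

/-- `Δₙ¹(x)` (counted over ordered pairs): class-1 regular triangles at `x` in `Ĝₙ`. -/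
def numTri1 (G R : SimpleGraph (Fin N)) (V1 : Finset (Fin N)) {n : ℕ} (x : Fin n → Fin N) :
    ℕ :=
  (univ.filter fun p : (Fin n → Fin N) × (Fin n → Fin N) =>
    GnEdge' G V1 x p.1 ∧ GnEdge' G V1 x p.2 ∧ REn R p.1 p.2).card

/-- `Δₙ²(x)` (counted over ordered pairs): class-2 regular triangles at `x` in `Ĝₙ`. -/
def numTri2 (G R : SimpleGraph (Fin N)) (V1 : Finset (Fin N)) {n : ℕ} (x : Fin n → Fin N) :
    ℕ :=
  (univ.filter fun p : (Fin n → Fin N) × (Fin n → Fin N) =>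
    GnEdge' G V1 x p.1 ∧ REn R x p.2 ∧ GnEdge' G V1 p.1 p.2).card

/-- `Δₙ^{ir}(x)` (counted over ordered pairs): irregular triangles at `x` in `Ĝₙ`. -/
def numTriIr (G R : SimpleGraph (Fin N)) (V1 : Finset (Fin N)) {n : ℕ} (x : Fin n → Fin N) :
    ℕ :=
  (univ.filter fun p : (Fin n → Fin N) × (Fin n → Fin N) =>
    hatAdj G R V1 x p.1 ∧ hatAdj G R V1 x p.2 ∧ hatAdj G R V1 p.1 p.2 ∧
      ¬exactlyTwoG G V1 x p.1 p.2).card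

/-- Exactly two of the three edges of the triangle `(x,y,z)` are edges of `G`. -/
def exactlyTwoB (G : SimpleGraph (Fin N)) (x y z : Fin N) : Prop :=
  (G.Adj x y ∧ G.Adj x z ∧ ¬G.Adj y z) ∨ (G.Adj x y ∧ ¬G.Adj x z ∧ G.Adj y z) ∨
    (¬G.Adj x y ∧ G.Adj x z ∧ G.Adj y z)

/-- `Δ¹(z)` (counted over ordered pairs): class-1 regular triangles at `z` in `Ĝ = G ⊔ R`. -/
def numTri1B (G R : SimpleGraph (Fin N)) (z : Fin N) : ℕ :=
  (univ.filter fun p : Fin N × Fin N => G.Adj z p.1 ∧ G.Adj z p.2 ∧ R.Adj p.1 p.2).card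

/-- `Δ²(z)` (counted over ordered pairs): class-2 regular triangles at `z` in `Ĝ = G ⊔ R`. -/
def numTri2B (G R : SimpleGraph (Fin N)) (z : Fin N) : ℕ :=
  (univ.filter fun p : Fin N × Fin N => G.Adj z p.1 ∧ R.Adj z p.2 ∧ G.Adj p.1 p.2).card

/-- `Δ^{ir}(z)` (counted over ordered pairs): irregular triangles at `z` in `Ĝ = G ⊔ R`. -/
def numTriIrB (G R : SimpleGraph (Fin N)) (z : Fin N) : ℕ :=
  (univ.filter fun p : Fin N × Fin N =>
    (G ⊔ R).Adj z p.1 ∧ (G ⊔ R).Adj z p.2 ∧ (G ⊔ R).Adj p.1 p.2 ∧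
      ¬exactlyTwoB G z p.1 p.2).card

/-- The number of ordered pairs of neighbors of `x` that are adjacent,
i.e. twice the number of triangles containing `x`. -/
def triOrd {α : Type*} [Fintype α] (H : SimpleGraph α) (x : α) : ℕ :=
  (univ.filter fun p : α × α => H.Adj x p.1 ∧ H.Adj x p.2 ∧ H.Adj p.1 p.2).card

/-- The local clustering coefficient
`C_x = #{edges between neighbors of x} / (deg x choose 2)`. -/
def clustering {α : Type*} [Fintype α] (H : SimpleGraph α) (x : α) : ℝ :=
  (triOrd H x : ℝ) / ((degH H x : ℝ) * ((degH H x : ℝ) - 1))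

/-- The degree of vertex `i` in the random graph `Gₙʳ` built from the digit variables `D`
(neighbors `j ≠ i` are counted). -/
def degR (G : SimpleGraph (Fin N)) (V1 : Finset (Fin N)) {n M : ℕ} {Ω : Type*}
    (D : Fin M → Fin n → Ω → Fin N) (i : Fin M) (ω : Ω) : ℕ :=
  (univ.filter fun j : Fin M => j ≠ i ∧
    EdgeRel G V1 (fun k => D i k ω) (fun k => D j k ω)).card

/-- `t_k = (d₁^{k+1} - 1)/(d₁ - 1) + 1`. -/
def tkD (d₁ k : ℕ) : ℝ := ((d₁ : ℝ) ^ (k + 1) - 1) / ((d₁ : ℝ) - 1) + 1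

/-- The words `x` and `y` agree before position `k`, are letterwise `G`-adjacent from `k` on, and
the letters of `x` from `k` on have the type of its last letter. -/
def LinkAt (G : SimpleGraph (Fin N)) (V1 : Finset (Fin N)) {m : ℕ} (k : Fin (m + 1))
    (x y : Fin (m + 1) → Fin N) : Prop :=
  (∀ i < k, x i = y i) ∧
    ∀ i, k ≤ i → G.Adj (x i) (y i) ∧ (x i ∈ V1 ↔ x (Fin.last m) ∈ V1)

theorem prefixLen_eq {n : ℕ} {x y : Fin n → Fin N} {k : Fin n} (h : ∀ i < k, x i = y i)
    (hk : x k ≠ y k) : prefixLen x y = k := by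
  have : (univ.filter fun i : Fin n => ∀ j : Fin n, j ≤ i → x j = y j) = Finset.Iio k := by
    ext i
    simp only [mem_filter, mem_univ, true_and, Finset.mem_Iio]
    exact ⟨fun hi => not_le.1 fun hki => hk (hi k hki),
      fun hi j hj => h j (hj.trans_lt hi)⟩
  rw [prefixLen, this, Fin.card_Iio]

theorem exists_first_ne {n : ℕ} {x y : Fin n → Fin N} (h : x ≠ y) :
    ∃ k : Fin n, (∀ i < k, x i = y i) ∧ x k ≠ y k := by
  obtain ⟨j, hj⟩ := Function.ne_iff.1 h
  obtain ⟨k, hk, hmin⟩ := WellFounded.has_min (wellFounded_lt (α := Fin n)) {i | x i ≠ y i} ⟨j, hj⟩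
  exact ⟨k, fun i hi => by_contra fun hne => hmin i hne hi, hk⟩

theorem LinkAt.symm {G : SimpleGraph (Fin N)} {V1 : Finset (Fin N)}
    (hbip : ∀ a b : Fin N, G.Adj a b → (a ∈ V1 ↔ b ∉ V1)) {m : ℕ} {k : Fin (m + 1)}
    {x y : Fin (m + 1) → Fin N} (h : LinkAt G V1 k x y) : LinkAt G V1 k y x := by
  refine ⟨fun i hi => (h.1 i hi).symm, fun i hi => ⟨(h.2 i hi).1.symm, ?_⟩⟩
  have h₁ := hbip _ _ (h.2 i hi).1
  have h₂ := hbip _ _ (h.2 _ (Fin.le_last k)).1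
  have h₃ := (h.2 i hi).2
  tauto

theorem gnEdge'_iff {G : SimpleGraph (Fin N)} {V1 : Finset (Fin N)}
    (hbip : ∀ a b : Fin N, G.Adj a b → (a ∈ V1 ↔ b ∉ V1)) {m : ℕ}
    {x y : Fin (m + 1) → Fin N} : GnEdge' G V1 x y ↔ ∃ k, LinkAt G V1 k x y := by
  constructor
  · rintro ⟨hne, hxy⟩
    obtain ⟨k, hlt, hk⟩ := exists_first_ne hne
    obtain ⟨⟨t, ht, -⟩, hadj⟩ := hxy.resolve_left hne
    rw [prefixLen_eq hlt hk] at ht hadj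
    exact ⟨k, hlt, fun i hi => ⟨hadj i hi, (ht i hi).trans (ht _ (Fin.le_last k)).symm⟩⟩
  · rintro ⟨k, hlt, h⟩
    have hk : x k ≠ y k := (h k le_rfl).1.ne
    refine ⟨fun e => hk (congrFun e k), Or.inr ?_⟩
    rw [prefixLen_eq hlt hk]
    refine ⟨⟨decide (x (Fin.last m) ∈ V1), fun i hi => ?_, fun i hi => ?_⟩, fun i hi => (h i hi).1⟩
    · simpa using (h i hi).2
    · have h₁ := hbip _ _ (h i hi).1
      have h₂ := (h i hi).2
      simp only [Bool.not_eq_true', decide_eq_false_iff_not]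
      tauto

theorem rEn_succ_iff {R : SimpleGraph (Fin N)} {m : ℕ} {x y : Fin (m + 1) → Fin N} :
    REn R x y ↔ (∀ i, i ≠ Fin.last m → x i = y i) ∧ R.Adj (x (Fin.last m)) (y (Fin.last m)) := by
  constructor
  · rintro ⟨_, h, hR⟩
    refine ⟨fun i hi => h i ?_, hR⟩
    have := Fin.val_lt_last hi
    omega
  · rintro ⟨h, hR⟩
    refine ⟨m.succ_pos, fun i hi => h i ?_, hR⟩
    rintro rfl
    simp at hi

theorem REn.symm {R : SimpleGraph (Fin N)} {n : ℕ} {x y : Fin n → Fin N} (h : REn R x y) :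
    REn R y x :=
  ⟨h.1, fun i hi => (h.2.1 i hi).symm, h.2.2.symm⟩

theorem hatGn_adj_iff {G R : SimpleGraph (Fin N)} {V1 : Finset (Fin N)}
    (hbip : ∀ a b : Fin N, G.Adj a b → (a ∈ V1 ↔ b ∉ V1)) {m : ℕ}
    {x y : Fin (m + 1) → Fin N} :
    (HatGn G R V1 (m + 1)).Adj x y ↔ (∃ k, LinkAt G V1 k x y) ∨ REn R x y := by
  rw [HatGn, SimpleGraph.fromRel_adj]
  simp only [hatAdj, gnEdge'_iff hbip]
  constructor
  · rintro ⟨-, h | ⟨k, h⟩ | h⟩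
    · exact h
    · exact Or.inl ⟨k, h.symm hbip⟩
    · exact Or.inr h.symm
  · refine fun h => ⟨?_, Or.inl h⟩
    rintro rfl
    rcases h with ⟨k, h⟩ | ⟨_, _, h⟩
    · exact (h.2 k le_rfl).1.ne rfl
    · exact R.irrefl h

/-- Words joined by an edge of `Gₙ` have last letters of different types. -/
theorem last_mem_iff {G : SimpleGraph (Fin N)} {V1 : Finset (Fin N)}
    (hbip : ∀ a b : Fin N, G.Adj a b → (a ∈ V1 ↔ b ∉ V1)) {m : ℕ} {k : Fin (m + 1)}
    {x y : Fin (m + 1) → Fin N} (h : LinkAt G V1 k x y) :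
    x (Fin.last m) ∈ V1 ↔ y (Fin.last m) ∉ V1 :=
  hbip _ _ (h.2 _ (Fin.le_last k)).1

theorem rEn_right_injective {R : SimpleGraph (Fin N)} {m : ℕ} {x y z : Fin (m + 1) → Fin N}
    (hy : REn R x y) (hz : REn R x z) (h : y (Fin.last m) = z (Fin.last m)) : y = z := by
  rw [rEn_succ_iff] at hy hz
  funext i
  by_cases hi : i = Fin.last m
  · rw [hi, h]
  · rw [← hy.1 i hi, hz.1 i hi]

/-- The number of triangles at a vertex is at most linear in its degree. -/
theorem triOrd_hatGn_le {G R : SimpleGraph (Fin N)} {V1 : Finset (Fin N)}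
    (hbip : ∀ a b : Fin N, G.Adj a b → (a ∈ V1 ↔ b ∉ V1)) {m : ℕ} (x : Fin (m + 1) → Fin N) :
    triOrd (HatGn G R V1 (m + 1)) x ≤ 3 * (degH (HatGn G R V1 (m + 1)) x * N) := by
  set H := HatGn G R V1 (m + 1)
  let P := (Fin (m + 1) → Fin N) × (Fin (m + 1) → Fin N)
  let A : Finset P := univ.filter fun p => H.Adj x p.1 ∧ REn R p.1 p.2
  let B : Finset P := univ.filter fun p => H.Adj x p.1 ∧ REn R x p.2
  let C : Finset P := univ.filter fun p => H.Adj x p.2 ∧ REn R x p.1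
  have hsub : (univ.filter fun p : P => H.Adj x p.1 ∧ H.Adj x p.2 ∧ H.Adj p.1 p.2) ⊆
      A ∪ (B ∪ C) := by
    rintro ⟨y, z⟩ hp
    simp only [A, B, C, mem_filter, mem_univ, true_and, mem_union] at hp ⊢
    obtain ⟨hy, hz, hyz⟩ := hp
    rcases (hatGn_adj_iff hbip).1 hy with ⟨k, hk⟩ | h
    · rcases (hatGn_adj_iff hbip).1 hz with ⟨l, hl⟩ | h
      · rcases (hatGn_adj_iff hbip).1 hyz with ⟨j, hj⟩ | h
        · have h₁ := last_mem_iff hbip hk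
          have h₂ := last_mem_iff hbip hl
          have h₃ := last_mem_iff hbip hj
          tauto
        · exact Or.inl ⟨hy, h⟩
      · exact Or.inr (Or.inl ⟨hy, h⟩)
    · exact Or.inr (Or.inr ⟨hz, h⟩)
  have key : ∀ (S : Finset P) (f : P → (Fin (m + 1) → Fin N) × Fin N),
      (∀ p ∈ S, H.Adj x (f p).1) → Set.InjOn f S → S.card ≤ degH H x * N := by
    intro S f hS hf
    calc S.card ≤ ((univ.filter fun w => H.Adj x w) ×ˢ (univ : Finset (Fin N))).card :=
          Finset.card_le_card_of_injOn f (fun p hp => by simpa using hS p hp) hf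
      _ = degH H x * N := by rw [card_product, degH, Finset.card_univ, Fintype.card_fin]
  have hA : A.card ≤ degH H x * N := by
    refine key A (fun p => (p.1, p.2 (Fin.last m))) (fun p hp => (mem_filter.1 hp).2.1) ?_
    rintro ⟨y, z⟩ hp ⟨y', z'⟩ hq h
    obtain ⟨rfl, h⟩ := Prod.mk.inj h
    exact Prod.ext rfl (rEn_right_injective (mem_filter.1 hp).2.2 (mem_filter.1 hq).2.2 h)
  have hB : B.card ≤ degH H x * N := by
    refine key B (fun p => (p.1, p.2 (Fin.last m))) (fun p hp => (mem_filter.1 hp).2.1) ?_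
    rintro ⟨y, z⟩ hp ⟨y', z'⟩ hq h
    obtain ⟨rfl, h⟩ := Prod.mk.inj h
    exact Prod.ext rfl (rEn_right_injective (mem_filter.1 hp).2.2 (mem_filter.1 hq).2.2 h)
  have hC : C.card ≤ degH H x * N := by
    refine key C (fun p => (p.2, p.1 (Fin.last m))) (fun p hp => (mem_filter.1 hp).2.1) ?_
    rintro ⟨y, z⟩ hp ⟨y', z'⟩ hq h
    obtain ⟨rfl, h⟩ := Prod.mk.inj h
    exact Prod.ext (rEn_right_injective (mem_filter.1 hp).2.2 (mem_filter.1 hq).2.2 h) rfl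
  have h₁ : triOrd H x ≤ (A ∪ (B ∪ C)).card := Finset.card_le_card hsub
  have h₂ := Finset.card_union_le A (B ∪ C)
  have h₃ := Finset.card_union_le B C
  omega

theorem LinkAt.update_last {G : SimpleGraph (Fin N)} {V1 : Finset (Fin N)} {m : ℕ}
    {k : Fin (m + 1)} {x y : Fin (m + 1) → Fin N} (h : LinkAt G V1 k x y) {a b : Fin N}
    (hab : G.Adj a b) (ha : a ∈ V1 ↔ x (Fin.last m) ∈ V1) :
    LinkAt G V1 k (Function.update x (Fin.last m) a) (Function.update y (Fin.last m) b) := by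
  refine ⟨fun i hi => ?_, fun i hi => ?_⟩
  · have : i ≠ Fin.last m := (hi.trans_le (Fin.le_last k)).ne
    simpa [this] using h.1 i hi
  · by_cases hil : i = Fin.last m
    · subst hil
      simpa using hab
    · simpa [hil, ha] using h.2 i hi

theorem linkAt_update_last_self {G : SimpleGraph (Fin N)} {V1 : Finset (Fin N)} {m : ℕ}
    (x : Fin (m + 1) → Fin N) {a b : Fin N} (hab : G.Adj a b) :
    LinkAt G V1 (Fin.last m) (Function.update x (Fin.last m) a)
      (Function.update x (Fin.last m) b) := by
  refine ⟨fun i hi => by simp [hi.ne], fun i hi => ?_⟩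
  obtain rfl := Fin.last_le_iff.1 hi
  simpa using hab

theorem rEn_update_last {R : SimpleGraph (Fin N)} {m : ℕ} (x : Fin (m + 1) → Fin N) {a b : Fin N}
    (hab : R.Adj a b) :
    REn R (Function.update x (Fin.last m) a) (Function.update x (Fin.last m) b) :=
  rEn_succ_iff.2 ⟨fun i hi => by simp [hi], by simpa using hab⟩

/-- If `y` is a neighbor of `x`, and `c` has the type of the last letter of `x` and is
`G`-adjacent to `b`, then replacing the last letters of `x` and `y` by `c` and `b` produces an
edge of `Gₙ`. -/
theorem exists_linkAt_update_last {G R : SimpleGraph (Fin N)} {V1 : Finset (Fin N)}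
    (hbip : ∀ a b : Fin N, G.Adj a b → (a ∈ V1 ↔ b ∉ V1)) {m : ℕ} {x y : Fin (m + 1) → Fin N}
    (h : (HatGn G R V1 (m + 1)).Adj x y) {b c : Fin N} (hcb : G.Adj c b)
    (hc : c ∈ V1 ↔ x (Fin.last m) ∈ V1) :
    ∃ k, LinkAt G V1 k (Function.update x (Fin.last m) c)
      (Function.update y (Fin.last m) b) := by
  rcases (hatGn_adj_iff hbip).1 h with ⟨k, hk⟩ | hr
  · exact ⟨k, hk.update_last hcb hc⟩
  · have : Function.update y (Fin.last m) b = Function.update x (Fin.last m) b := by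
      funext i
      by_cases hi : i = Fin.last m
      · simp [hi]
      · simp [hi, (rEn_succ_iff.1 hr).1 i hi]
    rw [this]
    exact ⟨_, linkAt_update_last_self x hcb⟩

/-- Under Property R every vertex `x` has a letter `b` such that replacing the last letter of any
neighbor of `x` by `b` gives a vertex lying in a triangle at `x`. -/
theorem exists_letter_forall_triangle {G R : SimpleGraph (Fin N)} {V1 : Finset (Fin N)}
    (hbip : ∀ a b : Fin N, G.Adj a b → (a ∈ V1 ↔ b ∉ V1)) (hR : PropertyR G R) {m : ℕ}
    (x : Fin (m + 1) → Fin N) :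
    ∃ b, G.Adj (x (Fin.last m)) b ∧ ∀ y, (HatGn G R V1 (m + 1)).Adj x y →
      ∃ z, (HatGn G R V1 (m + 1)).Adj x (Function.update y (Fin.last m) b) ∧
        (HatGn G R V1 (m + 1)).Adj x z ∧
        (HatGn G R V1 (m + 1)).Adj (Function.update y (Fin.last m) b) z := by
  have hself : Function.update x (Fin.last m) (x (Fin.last m)) = x := Function.update_eq_self _ _
  have hlink : ∀ {y b}, (HatGn G R V1 (m + 1)).Adj x y → G.Adj (x (Fin.last m)) b →
      (HatGn G R V1 (m + 1)).Adj x (Function.update y (Fin.last m) b) := by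
    intro y b hy hb
    have := exists_linkAt_update_last hbip hy hb Iff.rfl
    rw [hself] at this
    exact (hatGn_adj_iff hbip).2 (Or.inl this)
  have hmixed : ∀ {b c}, G.Adj (x (Fin.last m)) b → R.Adj (x (Fin.last m)) c → G.Adj b c →
      ∀ y, (HatGn G R V1 (m + 1)).Adj x y →
      ∃ z, (HatGn G R V1 (m + 1)).Adj x (Function.update y (Fin.last m) b) ∧
        (HatGn G R V1 (m + 1)).Adj x z ∧
        (HatGn G R V1 (m + 1)).Adj (Function.update y (Fin.last m) b) z := by
    intro b c hb hc hbc y hy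
    have hcV : c ∈ V1 ↔ x (Fin.last m) ∈ V1 := (hbip _ _ hbc.symm).trans (hbip _ _ hb).symm
    refine ⟨Function.update x (Fin.last m) c, hlink hy hb, ?_, ?_⟩
    · have := rEn_update_last x hc
      rw [hself] at this
      exact (hatGn_adj_iff hbip).2 (Or.inr this)
    · exact ((hatGn_adj_iff hbip).2
        (Or.inl (exists_linkAt_update_last hbip hy hbc.symm hcV))).symm
  obtain ⟨b, c, ⟨hb, hc, hbc⟩ | ⟨hb, hc, hbc⟩ | ⟨hb, hc, hbc⟩⟩ := hR (x (Fin.last m))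
  · exact ⟨b, hb, fun y hy => ⟨Function.update y (Fin.last m) c, hlink hy hb, hlink hy hc,
      (hatGn_adj_iff hbip).2 (Or.inr (rEn_update_last y hbc))⟩⟩
  · exact ⟨b, hb, hmixed hb hc hbc⟩
  · exact ⟨c, hc, hmixed hc hb hbc.symm⟩

/-- Under Property R the number of triangles at a vertex is at least linear in its degree. -/
theorem degH_hatGn_le {G R : SimpleGraph (Fin N)} {V1 : Finset (Fin N)}
    (hbip : ∀ a b : Fin N, G.Adj a b → (a ∈ V1 ↔ b ∉ V1)) (hR : PropertyR G R) {m : ℕ}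
    (x : Fin (m + 1) → Fin N) :
    degH (HatGn G R V1 (m + 1)) x ≤ triOrd (HatGn G R V1 (m + 1)) x * N := by
  obtain ⟨b, -, h⟩ := exists_letter_forall_triangle hbip hR x
  choose! z hz using h
  set H := HatGn G R V1 (m + 1)
  let T : Finset ((Fin (m + 1) → Fin N) × (Fin (m + 1) → Fin N)) :=
    univ.filter fun p => H.Adj x p.1 ∧ H.Adj x p.2 ∧ H.Adj p.1 p.2
  calc degH H x ≤ (T ×ˢ (univ : Finset (Fin N))).card := by
        refine Finset.card_le_card_of_injOn
          (fun y => ((Function.update y (Fin.last m) b, z y), y (Fin.last m))) ?_ ?_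
        · intro y hy
          simpa [T] using hz y (mem_filter.1 hy).2
        · intro y _ y' _ he
          simp only [Prod.mk.injEq] at he
          funext i
          by_cases hi : i = Fin.last m
          · rw [hi, he.2]
          · simpa [hi] using congrFun he.1.1 i
    _ = triOrd H x * N := by rw [card_product, triOrd, Finset.card_univ, Fintype.card_fin]

theorem two_le_degH_hatGn {G R : SimpleGraph (Fin N)} {V1 : Finset (Fin N)}
    (hbip : ∀ a b : Fin N, G.Adj a b → (a ∈ V1 ↔ b ∉ V1)) (hR : PropertyR G R) {m : ℕ}
    (x : Fin (m + 1) → Fin N) : 2 ≤ degH (HatGn G R V1 (m + 1)) x := by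
  obtain ⟨b, hb, h⟩ := exists_letter_forall_triangle hbip hR x
  have hx := linkAt_update_last_self (V1 := V1) x hb
  rw [Function.update_eq_self] at hx
  obtain ⟨z, hy, hz, hyz⟩ := h _ ((hatGn_adj_iff hbip).2 (Or.inl ⟨_, hx⟩))
  exact Finset.one_lt_card.2 ⟨_, by simpa using hy, z, by simpa using hz, hyz.ne⟩

/-- there are constants `K₁, K₂ > 0`, independent of `n`, with
`K₁/deĝₙ(x) ≤ C_x ≤ K₂/deĝₙ(x)` for every vertex `x` of `Ĝₙ`. -/
theorem statement14 {N : ℕ} (G R : SimpleGraph (Fin N)) (V1 : Finset (Fin N))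
    (hV1 : V1.Nonempty) (hV2 : V1ᶜ.Nonempty)
    (hbip : ∀ a b : Fin N, G.Adj a b → (a ∈ V1 ↔ b ∉ V1))
    (hdisj : ∀ a b : Fin N, G.Adj a b → ¬R.Adj a b) (hR : PropertyR G R) :
    ∃ K₁ K₂ : ℝ, 0 < K₁ ∧ 0 < K₂ ∧
      ∀ n : ℕ, 0 < n → ∀ x : Fin n → Fin N,
        K₁ / (degH (HatGn G R V1 n) x : ℝ) ≤ clustering (HatGn G R V1 n) x ∧
          clustering (HatGn G R V1 n) x ≤ K₂ / (degH (HatGn G R V1 n) x : ℝ) := by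
  obtain ⟨v, -⟩ := hV1
  have hN : (0 : ℝ) < N := by exact_mod_cast v.pos
  refine ⟨1 / N, 6 * N, by positivity, by positivity, fun n hn x => ?_⟩
  obtain ⟨m, rfl⟩ := Nat.exists_eq_succ_of_ne_zero hn.ne'
  have hd : (2 : ℝ) ≤ degH (HatGn G R V1 (m + 1)) x := by
    exact_mod_cast two_le_degH_hatGn hbip hR x
  have hlow : (degH (HatGn G R V1 (m + 1)) x : ℝ) ≤ triOrd (HatGn G R V1 (m + 1)) x * N := by
    exact_mod_cast degH_hatGn_le hbip hR x
  have hupp : (triOrd (HatGn G R V1 (m + 1)) x : ℝ) ≤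
      3 * (degH (HatGn G R V1 (m + 1)) x * N) := by
    exact_mod_cast triOrd_hatGn_le hbip x
  simp only [clustering, Nat.succ_eq_add_one]
  generalize (degH (HatGn G R V1 (m + 1)) x : ℝ) = d at *
  generalize (triOrd (HatGn G R V1 (m + 1)) x : ℝ) = T at *
  have hd₀ : 0 < d := by linarith
  have hd₁ : 0 < d - 1 := by linarith
  rw [mul_comm d, ← div_div]
  constructor
  · refine div_le_div_of_nonneg_right ?_ hd₀.le
    rw [div_le_div_iff₀ hN hd₁]
    linarith
  · refine div_le_div_of_nonneg_right ?_ hd₀.le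
    rw [div_le_iff₀ hd₁]
    nlinarith

end HierGraph
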